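/- Let Π=(P,L) be a planar, connected and co-connected partial linear space such that: (a) every plane of Π is either isomorphic to a dual affine plane or is linear; (b) no linear plane of Π contains four distinct lines which pairwise meet and whose pairwise intersection points are six distinct points; (c) for all points x,y, x^⊥⊆y^⊥ implies x=y; (d) every line l has at least 4 points and satisfies l^{⊥⊥}=l, where l^⊥={z∈P : z⊥p for all p∈l} and l^{⊥⊥}={z∈P : z⊥u for all u∈l^⊥}. Then for every point x and every plane π of Π isomorphic to a dual affine plane, the set x^⊥∩π is empty, a single point, a line of Π contained in π, all of π, or a transversal of π. -/

import Mathlib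

universe u

/-- A *partial linear space*: a set of points `P` together with a set `L` of
subsets of `P` of size at least `2` (the *lines*), such that two distinct
points lie on at most one common line. -/
structure PLS (P : Type u) where
  L : Set (Set P)
  nontrivial_lines : ∀ l ∈ L, Set.Nontrivial l
  unique_line : ∀ l ∈ L, ∀ m ∈ L, ∀ x y : P, x ≠ y →
    x ∈ l → y ∈ l → x ∈ m → y ∈ m → l = m

namespace PLS

variable {P : Type u} (S : PLS P)

/-- `x ∼ y` : the points are distinct and lie on a common line. -/
def Collinear (x y : P) : Prop := x ≠ y ∧ ∃ l ∈ S.L, x ∈ l ∧ y ∈ l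

/-- `x ⊥ y` : `x = y` or `x` and `y` are non-collinear. -/
def Perp (x y : P) : Prop := ¬ S.Collinear x y

/-- `x^⊥` : the set of points `y` with `x ⊥ y`. -/
def perpSet (x : P) : Set P := {y | S.Perp x y}

/-- Adjacency in the graph `(P, ⊥)` : distinct points with `x ⊥ y`. -/
def PerpAdj (x y : P) : Prop := x ≠ y ∧ S.Perp x y

/-- `X^⊥` for a set `X` of points: points `⊥` to every point of `X`. -/
def setPerp (X : Set P) : Set P := {z | ∀ p ∈ X, S.Perp z p}

/-- `(xy)^{⊥⊥} = {z ∈ P : z ⊥ u for every u ∈ x^⊥ ∩ y^⊥}`. -/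
def doublePerp (x y : P) : Set P :=
  {z | ∀ u ∈ S.perpSet x ∩ S.perpSet y, S.Perp z u}

/-- A subspace: every line meeting it in at least two points is contained in it. -/
def IsSubspace (X : Set P) : Prop :=
  ∀ l ∈ S.L, (∃ x ∈ l ∩ X, ∃ y ∈ l ∩ X, x ≠ y) → l ⊆ X

/-- `⟨Y⟩`, the subspace generated by `Y`. -/
def span (Y : Set P) : Set P := ⋂₀ {X | S.IsSubspace X ∧ Y ⊆ X}

/-- A plane: the subspace generated by two distinct lines meeting in a point. -/
def IsPlane (X : Set P) : Prop :=
  ∃ l ∈ S.L, ∃ m ∈ S.L, l ≠ m ∧ (l ∩ m).Nonempty ∧ X = S.span (l ∪ m)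

/-- A transversal plane: a plane `X` such that for every line `ℓ ⊆ X` the sets
`x^⊥ ∩ X`, for `x ∈ ℓ`, partition `X` (every point of `X` lies in exactly one
of them). -/
def IsTransversalPlane (X : Set P) : Prop :=
  S.IsPlane X ∧ ∀ l ∈ S.L, l ⊆ X → ∀ p ∈ X, ∃! x, x ∈ l ∧ S.Perp x p

/-- `T` is a transversal of `X`: `T = x^⊥ ∩ X` for a point `x` on a line of `X`. -/
def IsTransversalOf (T X : Set P) : Prop :=
  ∃ l ∈ S.L, l ⊆ X ∧ ∃ x ∈ l, T = S.perpSet x ∩ X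

/-- Connectedness of the collinearity graph `(P, ∼)`. -/
def Connected : Prop := ∀ x y : P, Relation.ReflTransGen S.Collinear x y

/-- Connectedness of the graph `(P, ⊥)`. -/
def CoConnected : Prop := ∀ x y : P, Relation.ReflTransGen S.PerpAdj x y

/-- The one-or-all axiom for polar spaces. -/
def IsPolar : Prop :=
  ∀ p : P, ∀ l ∈ S.L, p ∉ l →
    (∃! q, q ∈ l ∧ S.Collinear p q) ∨ (∀ q ∈ l, S.Collinear p q)

/-- Non-degeneracy: the radical is empty, i.e. no point is collinear with all
other points. -/
def Nondegenerate : Prop := ∀ p : P, ∃ q, q ≠ p ∧ ¬ S.Collinear p q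

/-- In a polar space, `p^⊥` denotes the points equal or collinear to `p`. -/
def polarPerp (x : P) : Set P := {q | q = x ∨ S.Collinear x q}

/-- `X^⊥` in a polar space, for a set of points `X`. -/
def polarPerpSet (X : Set P) : Set P := {q | ∀ x ∈ X, q ∈ S.polarPerp x}

/-- The hyperbolic line on two non-collinear points of a polar space:
`{z : z ∈ u^⊥ for every u ∈ x^⊥ ∩ y^⊥}`. -/
def polarHypLine (x y : P) : Set P :=
  {z | ∀ u ∈ S.polarPerp x ∩ S.polarPerp y, z ∈ S.polarPerp u}

/-- A linear set: any two of its distinct points are collinear. -/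
def IsLinearSet (X : Set P) : Prop := ∀ x ∈ X, ∀ y ∈ X, x ≠ y → S.Collinear x y

/-- Planarity: any two distinct lines meeting in a point are contained in a
unique plane. -/
def Planar : Prop :=
  ∀ l ∈ S.L, ∀ m ∈ S.L, l ≠ m → (l ∩ m).Nonempty →
    ∃! π, S.IsPlane π ∧ l ⊆ π ∧ m ⊆ π

/-- A projective plane: a linear space in which any two distinct lines meet in
a point, containing four points no three of which are collinear. -/
def IsProjectivePlane : Prop :=
  (∀ x y : P, x ≠ y → ∃ l ∈ S.L, x ∈ l ∧ y ∈ l) ∧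
  (∀ l ∈ S.L, ∀ m ∈ S.L, l ≠ m → (l ∩ m).Nonempty) ∧
  (∃ a b c d : P, a ≠ b ∧ a ≠ c ∧ a ≠ d ∧ b ≠ c ∧ b ≠ d ∧ c ≠ d ∧
    ∀ l ∈ S.L, ¬(a ∈ l ∧ b ∈ l ∧ c ∈ l) ∧ ¬(a ∈ l ∧ b ∈ l ∧ d ∈ l) ∧
      ¬(a ∈ l ∧ c ∈ l ∧ d ∈ l) ∧ ¬(b ∈ l ∧ c ∈ l ∧ d ∈ l))

/-- `π` is isomorphic to a dual affine plane: there is a projective plane `T`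
on a point set `Q`, a point `p` of `T`, and a bijection from `π` onto `Q ∖ {p}`
under which the lines of `Π` contained in `π` correspond exactly to the lines
of `T` not passing through `p`. -/
def IsDualAffine (π : Set P) : Prop :=
  ∃ (Q : Type u) (T : PLS Q) (p : Q) (f : P → Q),
    T.IsProjectivePlane ∧ Set.BijOn f π {q | q ≠ p} ∧
    ∀ s : Set P, s ⊆ π → (s ∈ S.L ↔ f '' s ∈ T.L ∧ p ∉ f '' s)

/-- A linear plane contains four distinct lines which pairwise meet and whose
pairwise intersection points are six distinct points. -/
def FourLinesSixPoints (π : Set P) : Prop :=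
  ∃ l : Fin 4 → Set P, (∀ i, l i ∈ S.L ∧ l i ⊆ π) ∧ Function.Injective l ∧
    ∃ pt : Fin 4 → Fin 4 → P,
      (∀ i j, i < j → pt i j ∈ l i ∩ l j) ∧
      (∀ i j k m, i < j → k < m → (i, j) ≠ (k, m) → pt i j ≠ pt k m)

/-- Conditions (a)–(d) of the Main Hypothesis, for a connected and co-connected
partial linear space:
(a) all lines have at least `4` points;
(b) `x^⊥ ⊆ y^⊥` implies `x = y`;
(c) every triple `x ∼ y ∼ z`, `x ⊥ z`, `x ≠ z`, generates a transversal plane;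
(d) for every point `p` and transversal plane `π`, `p^⊥ ∩ π` is empty, a
point, a line, or a transversal of `π`. -/
def MainHyp : Prop :=
  S.Connected ∧ S.CoConnected ∧
  (∀ l ∈ S.L, 4 ≤ Cardinal.mk ↥l) ∧
  (∀ x y : P, S.perpSet x ⊆ S.perpSet y → x = y) ∧
  (∀ x y z : P, S.Collinear x y → S.Collinear y z → S.PerpAdj x z →
    S.IsTransversalPlane (S.span {x, y, z})) ∧
  (∀ p : P, ∀ π : Set P, S.IsTransversalPlane π →
    S.perpSet p ∩ π = ∅ ∨ (∃ q, S.perpSet p ∩ π = {q}) ∨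
    S.perpSet p ∩ π ∈ S.L ∨ S.IsTransversalOf (S.perpSet p ∩ π) π)

/-- Conditions (a)–(e) of the Setting, for a connected partial linear space:
(a) all lines have at least `4` points;
(b) `x^⊥ ⊆ y^⊥` implies `x^⊥ = y^⊥`;
(c) there exist two distinct non-collinear points;
(d) every triple `x ∼ y ∼ z`, `x ⊥ z`, `x ≠ z`, is contained in a transversal
plane;
(e) for every point `p` and transversal plane `π`, `p^⊥ ∩ π` is empty, a
point, a line, a transversal of `π`, or `π` itself. -/
def Setting : Prop :=
  S.Connected ∧
  (∀ l ∈ S.L, 4 ≤ Cardinal.mk ↥l) ∧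
  (∀ x y : P, S.perpSet x ⊆ S.perpSet y → S.perpSet x = S.perpSet y) ∧
  (∃ x y : P, x ≠ y ∧ ¬ S.Collinear x y) ∧
  (∀ x y z : P, S.Collinear x y → S.Collinear y z → S.PerpAdj x z →
    ∃ π, S.IsTransversalPlane π ∧ x ∈ π ∧ y ∈ π ∧ z ∈ π) ∧
  (∀ p : P, ∀ π : Set P, S.IsTransversalPlane π →
    S.perpSet p ∩ π = ∅ ∨ (∃ q, S.perpSet p ∩ π = {q}) ∨
    S.perpSet p ∩ π ∈ S.L ∨ S.IsTransversalOf (S.perpSet p ∩ π) π ∨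
    S.perpSet p ∩ π = π)

end PLS

namespace PLS

theorem Collinear.symm' {P : Type u} {S : PLS P} {x y : P} (h : S.Collinear x y) :
    S.Collinear y x := ⟨h.1.symm, by obtain ⟨l, hl, a, b⟩ := h.2; exact ⟨l, hl, b, a⟩⟩

theorem Perp.symm' {P : Type u} {S : PLS P} {x y : P} (h : S.Perp x y) :
    S.Perp y x := fun h' => h h'.symm'

theorem perp_refl' {P : Type u} (S : PLS P) (x : P) : S.Perp x x := fun h => h.1 rfl

theorem span_sub {P : Type u} (S : PLS P) (Y : Set P) : S.IsSubspace (S.span Y) := by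
  rintro l hl ⟨x, hx, y, hy, hxy⟩ z hz X hX
  exact hX.1 l hl ⟨x, ⟨hx.1, hx.2 X hX⟩, y, ⟨hy.1, hy.2 X hX⟩, hxy⟩ hz

theorem sub_span {P : Type u} (S : PLS P) (Y : Set P) : Y ⊆ S.span Y :=
  fun _ hy _ hX => hX.2 hy

theorem IsPlane.sub {P : Type u} {S : PLS P} {π : Set P} (h : S.IsPlane π) :
    S.IsSubspace π := by
  obtain ⟨l, _, m, _, _, _, rfl⟩ := h
  exact S.span_sub _

theorem dual_props {P : Type u} {S : PLS P} {π : Set P} (hsub : S.IsSubspace π)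
    (h : S.IsDualAffine π) :
    (∀ l ∈ S.L, ∀ m ∈ S.L, l ⊆ π → m ⊆ π → l ≠ m → (l ∩ m).Nonempty) ∧
    (∀ l ∈ S.L, l ⊆ π → ∀ q ∈ π, ∃ t ∈ l, S.Perp t q ∧ ∀ t' ∈ l, S.Perp t' q → t' = t) ∧
    (∀ a ∈ π, ∀ b ∈ π, ∀ c ∈ π, S.Perp a b → S.Perp b c → S.Perp a c) := by
  obtain ⟨Q, T, p, f, ⟨hP1, hP2, _⟩, hf, hs⟩ := h
  have key1 : ∀ a ∈ π, ∀ b ∈ π, S.Collinear a b →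
      ∃ M ∈ T.L, f a ∈ M ∧ f b ∈ M ∧ p ∉ M := by
    rintro a ha b hb ⟨hab, l, hl, hal, hbl⟩
    have hlπ : l ⊆ π := hsub l hl ⟨a, ⟨hal, ha⟩, b, ⟨hbl, hb⟩, hab⟩
    have := (hs l hlπ).1 hl
    exact ⟨f '' l, this.1, ⟨a, hal, rfl⟩, ⟨b, hbl, rfl⟩, this.2⟩
  have key2 : ∀ a ∈ π, ∀ b ∈ π, a ≠ b → ∀ M ∈ T.L, f a ∈ M → f b ∈ M → p ∉ M →
      S.Collinear a b := by
    intro a ha b hb hab M hM haM hbM hpM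
    have himg : f '' (π ∩ f ⁻¹' M) = M := by
      ext z
      constructor
      · rintro ⟨y, hy, rfl⟩; exact hy.2
      · intro hz
        have hzp : z ≠ p := fun h => hpM (h ▸ hz)
        obtain ⟨y, hy, rfl⟩ := hf.surjOn hzp
        exact ⟨y, ⟨hy, hz⟩, rfl⟩
    refine ⟨hab, π ∩ f ⁻¹' M, ?_, ⟨ha, haM⟩, ⟨hb, hbM⟩⟩
    rw [hs _ Set.inter_subset_left, himg]
    exact ⟨hM, hpM⟩
  have hne : ∀ a ∈ π, f a ≠ p := fun a ha => hf.mapsTo ha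
  have key3 : ∀ a ∈ π, ∀ b ∈ π, a ≠ b → S.Perp a b →
      ∃ M ∈ T.L, f a ∈ M ∧ f b ∈ M ∧ p ∈ M := by
    intro a ha b hb hab hperp
    obtain ⟨M, hM, h1, h2⟩ := hP1 (f a) (f b) (fun h => hab (hf.injOn ha hb h))
    by_cases hp : p ∈ M
    · exact ⟨M, hM, h1, h2, hp⟩
    · exact absurd (key2 a ha b hb hab M hM h1 h2 hp) hperp
  refine ⟨?_, ?_, ?_⟩
  · intro l hl m hm hlπ hmπ hlm
    have h1 := (hs l hlπ).1 hl
    have h2 := (hs m hmπ).1 hm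
    obtain ⟨z, ⟨x, hx, hxz⟩, ⟨y, hy, hyz⟩⟩ := hP2 _ h1.1 _ h2.1 (fun h =>
      hlm ((hf.injOn.image_eq_image_iff hlπ hmπ).1 h))
    have : x = y := hf.injOn (hlπ hx) (hmπ hy) (hxz.trans hyz.symm)
    exact ⟨x, hx, this ▸ hy⟩
  · intro l hl hlπ q hq
    by_cases hql : q ∈ l
    · refine ⟨q, hql, S.perp_refl' q, ?_⟩
      intro t' ht' hp
      by_contra hne
      exact hp ⟨hne, l, hl, ht', hql⟩
    · have h1 := (hs l hlπ).1 hl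
      obtain ⟨M, hM, hqM, hpM⟩ := hP1 (f q) p (hne q hq)
      obtain ⟨z, hzM, t, ht, rfl⟩ := hP2 M hM _ h1.1 (fun h => h1.2 (h ▸ hpM))
      refine ⟨t, ht, ?_, ?_⟩
      · intro hcol
        obtain ⟨M', hM', a1, a2, a3⟩ := key1 t (hlπ ht) q hq hcol
        have : M' = M := T.unique_line M' hM' M hM (f t) (f q)
          (fun h => hcol.1 (hf.injOn (hlπ ht) hq h)) a1 a2 hzM hqM
        exact a3 (this ▸ hpM)
      · intro t' ht' hperp
        have ht'q : t' ≠ q := fun h => hql (h ▸ ht')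
        obtain ⟨N, hN, b1, b2, b3⟩ := key3 t' (hlπ ht') q hq ht'q hperp
        have hNM : N = M := T.unique_line N hN M hM (f q) p (hne q hq) b2 b3 hqM hpM
        subst hNM
        by_contra hcon
        have : N = f '' l := T.unique_line N hN _ h1.1 (f t') (f t)
          (fun h => hcon (hf.injOn (hlπ ht') (hlπ ht) h)) b1 hzM ⟨t', ht', rfl⟩ ⟨t, ht, rfl⟩
        exact h1.2 (this ▸ hpM)
  · intro a ha b hb c hc hab hbc hac
    have h1 : a ≠ b := fun h => hbc (h ▸ hac)
    have h2 : b ≠ c := fun h => hab (h ▸ hac)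
    obtain ⟨N, hN, n1, n2, n3⟩ := key3 a ha b hb h1 hab
    obtain ⟨N', hN', m1, m2, m3⟩ := key3 b hb c hc h2 hbc
    have e : N = N' := T.unique_line N hN N' hN' (f b) p (hne b hb) n2 n3 m1 m3
    subst e
    obtain ⟨M, hM, o1, o2, o3⟩ := key1 a ha c hc hac
    have e : N = M := T.unique_line N hN M hM (f a) (f c)
      (fun h => hac.1 (hf.injOn ha hc h)) n1 m2 o1 o2
    exact o3 (e ▸ n3)

section
variable {P : Type u} {S : PLS P}

/-- a point perp to two points of a line is perp to the whole line -/
theorem perp_line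
    (ha : ∀ π : Set P, S.IsPlane π → S.IsDualAffine π ∨ S.IsLinearSet π)
    {x p q r : P} {l : Set P} (hl : l ∈ S.L) (hp : p ∈ l) (hq : q ∈ l) (hpq : p ≠ q)
    (hxp : S.Perp x p) (hxq : S.Perp x q) (hr : r ∈ l) : S.Perp x r := by
  intro hxr
  by_cases hxl : x ∈ l
  · by_cases h : x = p
    · subst h; exact hxq ⟨hpq, l, hl, hxl, hq⟩
    · exact hxp ⟨h, l, hl, hxl, hp⟩
  · obtain ⟨_, m, hm, hxm, hrm⟩ := hxr
    have hlm : l ≠ m := fun h => hxl (h ▸ hxm)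
    have hpl : S.IsPlane (S.span (l ∪ m)) := ⟨l, hl, m, hm, hlm, ⟨r, hr, hrm⟩, rfl⟩
    have hls : l ⊆ S.span (l ∪ m) := Set.subset_union_left.trans (S.sub_span _)
    have hxs : x ∈ S.span (l ∪ m) := S.sub_span _ (Or.inr hxm)
    rcases ha _ hpl with h | h
    · obtain ⟨t, _, _, ht⟩ := (dual_props hpl.sub h).2.1 l hl hls x hxs
      exact hpq ((ht p hp hxp.symm').trans (ht q hq hxq.symm').symm)
    · exact hxp (h x hxs p (hls hp) (fun e => hxl (e ▸ hp)))

theorem third_point (h4 : ∀ l ∈ S.L, 4 ≤ Cardinal.mk ↥l) {l : Set P} (hl : l ∈ S.L)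
    (a b : P) : ∃ c ∈ l, c ≠ a ∧ c ≠ b := by
  by_contra hcon
  push Not at hcon
  have hsub : l ⊆ {a, b} := by
    intro c hc
    by_cases h : c = a
    · exact Or.inl h
    · exact Or.inr (hcon c hc h)
  have h1 := Cardinal.mk_le_mk_of_subset hsub
  have h2 : Cardinal.mk ↥({a, b} : Set P) ≤ 2 := by
    refine (Cardinal.mk_insert_le).trans ?_
    rw [Cardinal.mk_singleton, one_add_one_eq_two]
  have h3 := ((h4 l hl).trans h1).trans h2
  exact absurd h3 (by norm_num)

/-- existence of the point `v` -/
theorem get_v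
    (ha : ∀ π : Set P, S.IsPlane π → S.IsDualAffine π ∨ S.IsLinearSet π)
    {x u z a : P} {k m : Set P} (hk : k ∈ S.L) (hm : m ∈ S.L)
    (huk : u ∈ k) (hzk : z ∈ k) (hak : a ∈ k) (hxm : x ∈ m) (hum : u ∈ m)
    (hxu : x ≠ u) (hxz : S.Perp x z) (hne : x ≠ z) (haz : a ≠ z) (hau : a ≠ u) :
    ∃ v ∈ m, S.Perp a v ∧ v ≠ x ∧ v ≠ u := by
  have hkm : k ≠ m := fun h => hxz ⟨hne, m, hm, hxm, h ▸ hzk⟩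
  have hpl : S.IsPlane (S.span (k ∪ m)) := ⟨k, hk, m, hm, hkm, ⟨u, huk, hum⟩, rfl⟩
  have hks : k ⊆ S.span (k ∪ m) := Set.subset_union_left.trans (S.sub_span _)
  have hms : m ⊆ S.span (k ∪ m) := Set.subset_union_right.trans (S.sub_span _)
  rcases ha _ hpl with h | h
  · obtain ⟨v, hv, hva, _⟩ := (dual_props hpl.sub h).2.1 m hm hms a (hks hak)
    refine ⟨v, hv, hva.symm', ?_, ?_⟩
    · rintro rfl
      exact perp_line ha hk hak hzk haz hva hxz huk ⟨hxu, m, hm, hv, hum⟩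
    · rintro rfl
      exact hva ⟨hau.symm, k, hk, huk, hak⟩
  · exact absurd (h x (hms hxm) z (hks hzk) hne) hxz

theorem four_lines {E l0 l1 l2 l3 : Set P} {a b c d e f : P}
    (h0 : l0 ∈ S.L) (h1 : l1 ∈ S.L) (h2 : l2 ∈ S.L) (h3 : l3 ∈ S.L)
    (k0 : l0 ⊆ E) (k1 : l1 ⊆ E) (k2 : l2 ⊆ E) (k3 : l3 ⊆ E)
    (n01 : l0 ≠ l1) (n02 : l0 ≠ l2) (n03 : l0 ≠ l3) (n12 : l1 ≠ l2) (n13 : l1 ≠ l3)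
    (n23 : l2 ≠ l3)
    (p01 : a ∈ l0 ∩ l1) (p02 : b ∈ l0 ∩ l2) (p03 : c ∈ l0 ∩ l3) (p12 : d ∈ l1 ∩ l2)
    (p13 : e ∈ l1 ∩ l3) (p23 : f ∈ l2 ∩ l3)
    (ab : a ≠ b) (ac : a ≠ c) (ad : a ≠ d) (ae : a ≠ e) (af : a ≠ f)
    (bc : b ≠ c) (bd : b ≠ d) (be : b ≠ e) (bf : b ≠ f)
    (cd : c ≠ d) (ce : c ≠ e) (cf : c ≠ f) (de : d ≠ e) (df : d ≠ f) (ef : e ≠ f) :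
    S.FourLinesSixPoints E := by
  refine ⟨![l0, l1, l2, l3], ?_, ?_, ![![a, a, b, c], ![a, a, d, e], ![a, a, a, f],
    ![a, a, a, a]], ?_, ?_⟩
  · intro i
    fin_cases i
    exacts [⟨h0, k0⟩, ⟨h1, k1⟩, ⟨h2, k2⟩, ⟨h3, k3⟩]
  · intro i j hij
    by_contra hne
    revert hij
    change _ ≠ _
    fin_cases i <;> fin_cases j <;> first
      | exact absurd rfl hne
      | assumption
      | (apply Ne.symm; assumption)
  · intro i j hij
    fin_cases i <;> fin_cases j <;> first
      | (exfalso; revert hij; decide)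
      | assumption
  · intro i j k m hij hkm hne
    fin_cases i <;> fin_cases j <;> first
      | (exfalso; revert hij; decide)
      | (fin_cases k <;> fin_cases m <;> first
          | (exfalso; revert hkm; decide)
          | (exfalso; exact hne rfl)
          | assumption
          | (apply Ne.symm; assumption))

theorem main_contra
    (hplanar : S.Planar)
    (ha : ∀ π : Set P, S.IsPlane π → S.IsDualAffine π ∨ S.IsLinearSet π)
    (hb : ∀ π : Set P, S.IsPlane π → S.IsLinearSet π → ¬ S.FourLinesSixPoints π)
    (h4 : ∀ l ∈ S.L, 4 ≤ Cardinal.mk ↥l)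
    {π : Set P} (hπ : S.IsPlane π) (hdπ : S.IsDualAffine π) {x y z w : P}
    (hy : y ∈ π) (hz : z ∈ π) (hw : w ∈ π) (hyz : y ≠ z)
    (hyzp : S.Perp y z) (hyw : S.Perp y w) (hxy : S.Perp x y) (hxz : S.Perp x z)
    (hxw : S.Collinear x w)
    (hxall : ∀ e ∈ π, S.Collinear e w → S.Collinear x e) : False := by
  obtain ⟨D1, D2, D3⟩ := dual_props hπ.sub hdπ
  have hzw : S.Perp z w := D3 z hz y hy w hw hyzp.symm' hyw
  have hsub := hπ.sub
  have hnwy : w ≠ y := fun h => hxy (h ▸ hxw)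
  have hnwz : w ≠ z := fun h => hxz (h ▸ hxw)
  have hnxy : x ≠ y := fun h => hyw (h ▸ hxw)
  have hnxz : x ≠ z := fun h => hzw (h ▸ hxw)
  -- a point c of π collinear with w
  obtain ⟨l0, hl0, hl0π⟩ : ∃ l ∈ S.L, l ⊆ π := by
    obtain ⟨l, hl, m, hm, _, _, rfl⟩ := hπ
    exact ⟨l, hl, Set.subset_union_left.trans (S.sub_span _)⟩
  obtain ⟨t, _, _, htu⟩ := D2 l0 hl0 hl0π w hw
  obtain ⟨c, hc0, hct, -⟩ := third_point h4 hl0 t t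
  have hcπ := hl0π hc0
  have hcw : S.Collinear c w := by
    by_contra h; exact hct (htu c hc0 h)
  obtain ⟨hncw, n, hn, hcn, hwn⟩ := hcw
  have hnπ : n ⊆ π := hsub n hn ⟨c, ⟨hcn, hcπ⟩, w, ⟨hwn, hw⟩, hncw⟩
  have hyn : y ∉ n := fun h => hyw ⟨hnwy.symm, n, hn, h, hwn⟩
  have hzn : z ∉ n := fun h => hzw ⟨hnwz.symm, n, hn, h, hwn⟩
  have hxn : ∀ e ∈ n, S.Collinear x e := by
    intro e he
    by_cases h : e = w
    · rw [h]; exact hxw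
    · exact hxall e (hnπ he) ⟨h, n, hn, he, hwn⟩
  have hxnn : x ∉ n := fun h => (hxn x h).1 rfl
  have hncol : ∀ e ∈ n, e ≠ w → ∀ s ∈ π, S.Perp s w → S.Collinear e s := by
    intro e he hew s hs hsw
    by_contra h
    exact (D3 e (hnπ he) s hs w hw h hsw) ⟨hew, n, hn, he, hwn⟩
  -- the point a
  obtain ⟨a, haπ, hac, hpac⟩ : ∃ a ∈ π, a ≠ c ∧ S.Perp a c := by
    obtain ⟨e, he, hec, hew⟩ := third_point h4 hn c w
    obtain ⟨hney, k, hk, hek, hyk⟩ := hncol e he hew y hy hyw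
    have hkπ : k ⊆ π := hsub k hk ⟨e, ⟨hek, hnπ he⟩, y, ⟨hyk, hy⟩, hney⟩
    have hck : c ∉ k := by
      intro h
      have : k = n := S.unique_line k hk n hn e c hec hek h he hcn
      exact hyn (this ▸ hyk)
    obtain ⟨a, hak, hap, _⟩ := D2 k hk hkπ c hcπ
    exact ⟨a, hkπ hak, fun h => hck (h ▸ hak), hap⟩
  have han : a ∉ n := fun h => hpac ⟨hac, n, hn, h, hcn⟩
  have haw : S.Collinear a w := by
    by_contra h
    exact D3 c hcπ a haπ w hw hpac.symm' h ⟨hncw, n, hn, hcn, hwn⟩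
  -- the points u
  have getu : ∀ s ∈ π, S.Perp s w → s ≠ w → s ∉ n → ∃ k ∈ S.L, a ∈ k ∧ s ∈ k ∧ a ≠ s ∧
      ∃ u ∈ n, u ∈ k ∧ u ≠ w ∧ u ≠ c := by
    intro s hs hsw hnsw hsn
    have has : S.Collinear a s := by
      by_contra h
      exact D3 a haπ s hs w hw h hsw haw
    obtain ⟨hnas, k, hk, hak, hsk⟩ := has
    have hkπ : k ⊆ π := hsub k hk ⟨a, ⟨hak, haπ⟩, s, ⟨hsk, hs⟩, hnas⟩
    obtain ⟨u, huk, hun⟩ := D1 k hk n hn hkπ hnπ (fun h => hsn (h ▸ hsk))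
    refine ⟨k, hk, hak, hsk, hnas, u, hun, huk, ?_, ?_⟩
    · rintro rfl; exact hsw ⟨hnsw, k, hk, hsk, huk⟩
    · rintro rfl; exact hpac ⟨hac, k, hk, hak, huk⟩
  obtain ⟨k1, hk1, hak1, hyk1, hnay, u1, hu1n, hu1k, hu1w, hu1c⟩ := getu y hy hyw hnwy.symm hyn
  obtain ⟨k2, hk2, hak2, hzk2, hnaz, u2, hu2n, hu2k, hu2w, hu2c⟩ := getu z hz hzw hnwz.symm hzn
  have hu12 : u1 ≠ u2 := by
    rintro rfl
    have hau : a ≠ u1 := fun h => han (h ▸ hu1n)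
    have : k1 = k2 := S.unique_line k1 hk1 k2 hk2 a u1 hau hak1 hu1k hak2 hu2k
    exact hyzp ⟨hyz, k2, hk2, this ▸ hyk1, hzk2⟩
  have hau1 : a ≠ u1 := fun h => han (h ▸ hu1n)
  have hau2 : a ≠ u2 := fun h => han (h ▸ hu2n)
  obtain ⟨hxu1, m1, hm1, hxm1, hum1⟩ := hxn u1 hu1n
  obtain ⟨hxu2, m2, hm2, hxm2, hum2⟩ := hxn u2 hu2n
  obtain ⟨v1, hv1, hav1, hv1x, hv1u⟩ :=
    get_v ha hk1 hm1 hu1k hyk1 hak1 hxm1 hum1 hxu1 hxy hnxy hnay hau1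
  obtain ⟨v2, hv2, hav2, hv2x, hv2u⟩ :=
    get_v ha hk2 hm2 hu2k hzk2 hak2 hxm2 hum2 hxu2 hxz hnxz hnaz hau2
  -- the linear plane E
  have hnm1 : n ≠ m1 := fun h => hxnn (h ▸ hxm1)
  have hnm2 : n ≠ m2 := fun h => hxnn (h ▸ hxm2)
  have hm12 : m1 ≠ m2 := by
    rintro rfl
    exact hnm1 (S.unique_line n hn m1 hm1 u1 u2 hu12 hu1n hu2n hum1 hum2)
  obtain ⟨E, hE⟩ : ∃ E, E = S.span (n ∪ m1) := ⟨_, rfl⟩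
  have hEpl : S.IsPlane E := ⟨n, hn, m1, hm1, hnm1, ⟨u1, hu1n, hum1⟩, hE⟩
  have hnE : n ⊆ E := by rw [hE]; exact Set.subset_union_left.trans (S.sub_span _)
  have hm1E : m1 ⊆ E := by rw [hE]; exact Set.subset_union_right.trans (S.sub_span _)
  have hEs := hEpl.sub
  have hm2E : m2 ⊆ E := hEs m2 hm2 ⟨x, ⟨hxm2, hm1E hxm1⟩, u2, ⟨hum2, hnE hu2n⟩, hxu2⟩
  have hElin : S.IsLinearSet E := by
    rcases ha E hEpl with h | h
    · obtain ⟨t, ht, htx, _⟩ := (dual_props hEs h).2.1 n hn hnE x (hm1E hxm1)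
      exact absurd (hxn t ht).symm' htx
    · exact h
  have hv1n : v1 ∉ n := fun h =>
    hnm1 (S.unique_line n hn m1 hm1 v1 u1 hv1u h hu1n hv1 hum1)
  have hv2n : v2 ∉ n := fun h =>
    hnm2 (S.unique_line n hn m2 hm2 v2 u2 hv2u h hu2n hv2 hum2)
  have hv1m2 : v1 ∉ m2 := fun h =>
    hm12 (S.unique_line m1 hm1 m2 hm2 v1 x hv1x hv1 hxm1 h hxm2)
  have hv2m1 : v2 ∉ m1 := fun h =>
    hm12 (S.unique_line m1 hm1 m2 hm2 v2 x hv2x h hxm1 hv2 hxm2)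
  have hv1c : v1 ≠ c := fun h => hv1n (h ▸ hcn)
  have hv2c : v2 ≠ c := fun h => hv2n (h ▸ hcn)
  have hv12 : v1 ≠ v2 := fun h => hv1m2 (h ▸ hv2)
  obtain ⟨-, L, hL, hv1L, hcL⟩ := hElin v1 (hm1E hv1) c (hnE hcn) hv1c
  obtain ⟨-, L', hL', hv2L', hcL'⟩ := hElin v2 (hm2E hv2) c (hnE hcn) hv2c
  have hLE : L ⊆ E := hEs L hL ⟨v1, ⟨hv1L, hm1E hv1⟩, c, ⟨hcL, hnE hcn⟩, hv1c⟩
  have hLE' : L' ⊆ E := hEs L' hL' ⟨v2, ⟨hv2L', hm2E hv2⟩, c, ⟨hcL', hnE hcn⟩, hv2c⟩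
  have hLL : L = L' := by
    by_contra hne
    have hne' : (L ∩ L').Nonempty := ⟨c, hcL, hcL'⟩
    have hpl : S.IsPlane (S.span (L ∪ L')) := ⟨L, hL, L', hL', hne, hne', rfl⟩
    obtain ⟨ρ, _, hρ⟩ := hplanar L hL L' hL' hne hne'
    have e : E = S.span (L ∪ L') := (hρ E ⟨hEpl, hLE, hLE'⟩).trans
      (hρ _ ⟨hpl, Set.subset_union_left.trans (S.sub_span _),
        Set.subset_union_right.trans (S.sub_span _)⟩).symm
    have hu : u1 ∈ S.span (L ∪ L') := e ▸ hnE hu1n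
    have : u1 ∈ S.perpSet a := by
      apply hu
      refine ⟨?_, ?_⟩
      · rintro l hl ⟨p, hp, q, hq, hpq⟩ r hr
        exact perp_line ha hl hp.1 hq.1 hpq hp.2 hq.2 hr
      · rintro r (hr | hr)
        · exact perp_line ha hL hv1L hcL hv1c hav1 hpac hr
        · exact perp_line ha hL' hv2L' hcL' hv2c hav2 hpac hr
    exact this ⟨hau1, k1, hk1, hak1, hu1k⟩
  subst hLL
  have hnL : n ≠ L := fun h => hv1n (h ▸ hv1L)
  have hm1L : m1 ≠ L := fun h => hv2m1 (h ▸ hv2L')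
  have hm2L : m2 ≠ L := fun h => hv1m2 (h ▸ hv1L)
  have hxv1 := hv1x.symm
  have hxv2 := hv2x.symm
  have hxc : x ≠ c := fun h => hxnn (h ▸ hcn)
  have hu1v1 := hv1u.symm
  have hu2v2 := hv2u.symm
  have hu1v2 : u1 ≠ v2 := fun h => hv2n (h ▸ hu1n)
  have hu2v1 : u2 ≠ v1 := fun h => hv1n (h ▸ hu2n)
  apply hb E hEpl hElin
  exact four_lines hm1 hm2 hn hL hm1E hm2E hnE hLE hm12 hnm1.symm hm1L hnm2.symm hm2L hnL
    ⟨hxm1, hxm2⟩ ⟨hum1, hu1n⟩ ⟨hv1, hv1L⟩ ⟨hum2, hu2n⟩ ⟨hv2, hv2L'⟩ ⟨hcn, hcL⟩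
    hxu1 hxv1 hxu2 hxv2 hxc hu1v1 hu12 hu1v2 hu1c hu2v1.symm hv12 hv1c hu2v2 hu2c hv2c

end

end PLS

/-- 5.2. In a planar, connected and co-connected partial
linear space satisfying (a)–(d) of Theorem 1.2, for every point `x` and every
plane `π` isomorphic to a dual affine plane, `x^⊥ ∩ π` is empty, a point, a
line of `Π` contained in `π`, all of `π`, or a transversal of `π`. -/
theorem perp_meets_dual_affine_plane {P : Type u} (S : PLS P)
    (hplanar : S.Planar) (hconn : S.Connected) (hco : S.CoConnected)
    (ha : ∀ π : Set P, S.IsPlane π → S.IsDualAffine π ∨ S.IsLinearSet π)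
    (hb : ∀ π : Set P, S.IsPlane π → S.IsLinearSet π → ¬ S.FourLinesSixPoints π)
    (hc : ∀ x y : P, S.perpSet x ⊆ S.perpSet y → x = y)
    (hd : ∀ l ∈ S.L, 4 ≤ Cardinal.mk ↥l ∧ S.setPerp (S.setPerp l) = l) :
    ∀ x : P, ∀ π : Set P, S.IsPlane π → S.IsDualAffine π →
      S.perpSet x ∩ π = ∅ ∨ (∃ q, S.perpSet x ∩ π = {q}) ∨
      S.perpSet x ∩ π ∈ S.L ∨ S.perpSet x ∩ π = π ∨
      S.IsTransversalOf (S.perpSet x ∩ π) π := by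
  intro x π hπ hdπ
  have h4 : ∀ l ∈ S.L, 4 ≤ Cardinal.mk ↥l := fun l hl => (hd l hl).1
  obtain ⟨D1, D2, D3⟩ := PLS.dual_props hπ.sub hdπ
  have hsub := hπ.sub
  by_cases h0 : S.perpSet x ∩ π = ∅
  · exact Or.inl h0
  obtain ⟨y, hxy, hy⟩ := Set.nonempty_iff_ne_empty.2 h0
  by_cases h1 : S.perpSet x ∩ π = {y}
  · exact Or.inr (Or.inl ⟨y, h1⟩)
  by_cases hall : ∀ s ∈ S.perpSet x ∩ π, ∀ t ∈ S.perpSet x ∩ π, S.Perp s t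
  · obtain ⟨z, hz, hzy⟩ : ∃ z ∈ S.perpSet x ∩ π, z ≠ y := by
      by_contra hcon
      push Not at hcon
      exact h1 (Set.eq_singleton_iff_unique_mem.2 ⟨⟨hxy, hy⟩, hcon⟩)
    refine Or.inr (Or.inr (Or.inr (Or.inr ?_)))
    obtain ⟨l0, hl0, hl0π⟩ : ∃ l ∈ S.L, l ⊆ π := by
      obtain ⟨l, hl, m, hm, _, _, rfl⟩ := hπ
      exact ⟨l, hl, Set.subset_union_left.trans (S.sub_span _)⟩
    obtain ⟨t, _, _, htu⟩ := D2 l0 hl0 hl0π y hy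
    obtain ⟨c, hc0, hct, -⟩ := PLS.third_point h4 hl0 t t
    have hcπ := hl0π hc0
    have hcy : S.Collinear c y := by
      by_contra h; exact hct (htu c hc0 h)
    obtain ⟨hncy, n, hn, hcn, hyn⟩ := hcy
    refine ⟨n, hn, hsub n hn ⟨c, ⟨hcn, hcπ⟩, y, ⟨hyn, hy⟩, hncy⟩, y, hyn, ?_⟩
    apply Set.Subset.antisymm
    · intro s hs
      exact ⟨hall y ⟨hxy, hy⟩ s hs, hs.2⟩
    · rintro w ⟨hyw, hw⟩
      refine ⟨?_, hw⟩
      intro hxw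
      refine PLS.main_contra hplanar ha hb h4 hπ hdπ hy hz.2 hw hzy.symm
        (hall y ⟨hxy, hy⟩ z hz) hyw hxy hz.1 hxw ?_
      intro e he hew
      by_contra hxe
      exact D3 e he y hy w hw (hall e ⟨hxe, he⟩ y ⟨hxy, hy⟩) hyw hew
  · push Not at hall
    obtain ⟨s, hs, t, ht, hst⟩ := hall
    have hst : S.Collinear s t := not_not.1 hst
    obtain ⟨hnst, l, hl, hsl, htl⟩ := hst
    have hlπ : l ⊆ π := hsub l hl ⟨s, ⟨hsl, hs.2⟩, t, ⟨htl, ht.2⟩, hnst⟩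
    have hlX : l ⊆ S.perpSet x ∩ π := fun r hr =>
      ⟨PLS.perp_line ha hl hsl htl hnst hs.1 ht.1 hr, hlπ hr⟩
    by_cases hX : S.perpSet x ∩ π = l
    · exact Or.inr (Or.inr (Or.inl (hX ▸ hl)))
    refine Or.inr (Or.inr (Or.inr (Or.inl ?_)))
    obtain ⟨g, hg, hgl⟩ : ∃ g ∈ S.perpSet x ∩ π, g ∉ l := by
      by_contra hcon
      push Not at hcon
      exact hX (Set.Subset.antisymm hcon hlX)
    obtain ⟨t0, _, _, ht0⟩ := D2 l hl hlπ g hg.2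
    obtain ⟨r1, hr1, hr1t, -⟩ := PLS.third_point h4 hl t0 t0
    have hcol : S.Collinear r1 g := by
      by_contra h; exact hr1t (ht0 r1 hr1 h)
    obtain ⟨hnr1g, m, hm, hr1m, hgm⟩ := hcol
    have hmπ : m ⊆ π := hsub m hm ⟨r1, ⟨hr1m, hlπ hr1⟩, g, ⟨hgm, hg.2⟩, hnr1g⟩
    have hmX : ∀ r ∈ m, S.Perp x r := fun r hr =>
      PLS.perp_line ha hm hr1m hgm hnr1g (hlX hr1).1 hg.1 hr
    apply Set.Subset.antisymm Set.inter_subset_right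
    intro q hq
    refine ⟨?_, hq⟩
    by_cases hql : q ∈ l
    · exact (hlX hql).1
    obtain ⟨t1, _, _, ht1⟩ := D2 l hl hlπ q hq
    obtain ⟨r, hr, hrt, hrr1⟩ := PLS.third_point h4 hl t1 r1
    have hcol : S.Collinear r q := by
      by_contra h; exact hrt (ht1 r hr h)
    obtain ⟨hnrq, k, hk, hrk, hqk⟩ := hcol
    have hkπ : k ⊆ π := hsub k hk ⟨r, ⟨hrk, hlπ hr⟩, q, ⟨hqk, hq⟩, hnrq⟩
    have hrm : r ∉ m := fun h => by
      have : l = m := S.unique_line l hl m hm r r1 hrr1 hr hr1 h hr1m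
      exact hgl (this ▸ hgm)
    obtain ⟨v, hvk, hvm⟩ := D1 k hk m hm hkπ hmπ (fun h => hrm (h ▸ hrk))
    exact PLS.perp_line ha hk hvk hrk (fun h => hrm (h ▸ hvm)) (hmX v hvm) (hlX hr).1 hqk
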